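/- arXiv:2403.20133 — 6 statements merged into one kernel-verified Lean document; each statement's English description precedes it below -/
import Mathlib

section
/- Let ~ be an indistinguishability relation on Γ*, λ an information-consistent absorbing coloring, and h : Γ* → P a rectangular morphism. If a player strategy α is almost-sure winning from the information set [τ]~ for the reachability objective, then for every action a with α(τ)(a) > 0 and every move c with act(c) = a, the strategy α is almost-sure winning from [τc]~. -/
open MeasureTheory
open scoped Classical

section Games

variable {Γ A P : Type}

/-- Histories are finite words over the alphabet of moves. -/
abbrev Hist (Γ : Type) := List Γ

/-- The information set of a history: all histories indistinguishable from it. -/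
def InfoSet (sim : Hist Γ → Hist Γ → Prop) (τ : Hist Γ) : Set (Hist Γ) := {τ' | sim τ' τ}

/-- An indistinguishability relation: an equivalence relation such that related
histories have the same length, the relation is prefix-closed and actions are visible. -/
structure IsIndist (act : Γ → A) (sim : Hist Γ → Hist Γ → Prop) : Prop where
  equiv : Equivalence sim
  length_eq : ∀ τ τ' : Hist Γ, sim τ τ' → τ.length = τ'.length
  prefix_act : ∀ (τ τ' : Hist Γ) (c c' : Γ),
    sim (τ ++ [c]) (τ' ++ [c']) → sim τ τ' ∧ act c = act c'

/-- A function on histories is information consistent if it is constant on information sets. -/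
def InfoConsistent {C : Type} (sim : Hist Γ → Hist Γ → Prop) (lam : Hist Γ → C) : Prop :=
  ∀ τ τ' : Hist Γ, sim τ τ' → lam τ = lam τ'

/-- The coloring is absorbing: once a winning history, always winning. -/
def Absorbing (lam : Hist Γ → Bool) : Prop :=
  ∀ (τ : Hist Γ) (c : Γ), lam τ = true → lam (τ ++ [c]) = true

/-- A rectangular morphism for the game. -/
structure IsRectMorphism (sim : Hist Γ → Hist Γ → Prop) (lam : Hist Γ → Bool)
    (h : Hist Γ → P) : Prop where
  surj : Function.Surjective h
  rect : ∀ τ τ' : Hist Γ, h τ = h τ' → h '' InfoSet sim τ = h '' InfoSet sim τ'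
  morph : ∀ (τ τ' : Hist Γ) (c : Γ), h τ = h τ' → h (τ ++ [c]) = h (τ' ++ [c])
  refines : ∀ τ τ' : Hist Γ, h τ = h τ' → lam τ = lam τ'

/-- The relation ≈ on abstract states: ≈ = {(h τ, h τ') | τ ~ τ'}. -/
def approx (sim : Hist Γ → Hist Γ → Prop) (h : Hist Γ → P) (p p' : P) : Prop :=
  ∃ τ τ' : Hist Γ, sim τ τ' ∧ h τ = p ∧ h τ' = p'

/-- The extension of ≈ to P ⊕ (P × A). -/
def approxS (sim : Hist Γ → Hist Γ → Prop) (h : Hist Γ → P) :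
    (P ⊕ P × A) → (P ⊕ P × A) → Prop
  | Sum.inl p, Sum.inl p' => approx sim h p p'
  | Sum.inr (p, a), Sum.inr (p', a') => approx sim h p p' ∧ a = a'
  | _, _ => False

/-- The intr of a set under an equivalence relation. -/
def intr {S : Type} (r : S → S → Prop) (T : Set S) : Set S :=
  {t | ∀ t', r t' t → t' ∈ T}

/-- The set P_F of target (final) abstract states. -/
def targetSet (lam : Hist Γ → Bool) (h : Hist Γ → P) : Set P :=
  {p | ∃ τ : Hist Γ, h τ = p ∧ lam τ = true}

/-- The set P_F viewed inside P ⊕ (P × A). -/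
def targetS (A : Type) (lam : Hist Γ → Bool) (h : Hist Γ → P) : Set (P ⊕ P × A) :=
  Sum.inl '' targetSet lam h

/-- Membership in the predecessor operator. -/
def PreMem (act : Γ → A) (δP : P → Γ → P) (X : Set (P ⊕ P × A)) : (P ⊕ P × A) → Prop
  | Sum.inl p => ∃ a : A, Sum.inr (p, a) ∈ X
  | Sum.inr (p, a) => ∀ c : Γ, act c = a → Sum.inl (δP p c) ∈ X

/-- The predecessor operator Pre on subsets of P ⊕ (P × A). -/
def Pre (act : Γ → A) (δP : P → Γ → P) (X : Set (P ⊕ P × A)) : Set (P ⊕ P × A) :=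
  {s | PreMem act δP X s}

lemma Pre_mono (act : Γ → A) (δP : P → Γ → P) : Monotone (Pre act δP) := by
  intro X Y hXY s hs
  cases s with
  | inl p =>
      obtain ⟨a, ha⟩ := hs
      exact ⟨a, hXY ha⟩
  | inr pa =>
      obtain ⟨p, a⟩ := pa
      exact fun c hc => hXY (hs c hc)

/-- The inner (monotone) operator X ↦ int≈(Y) ∩ (Pre(X) ∪ P_F). -/
def innerOp (sim : Hist Γ → Hist Γ → Prop) (h : Hist Γ → P) (act : Γ → A)
    (δP : P → Γ → P) (lam : Hist Γ → Bool) (Y : Set (P ⊕ P × A)) :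
    Set (P ⊕ P × A) →o Set (P ⊕ P × A) :=
  ⟨fun X => intr (approxS sim h) Y ∩ (Pre act δP X ∪ targetS A lam h),
   fun _ _ hXX' =>
     Set.inter_subset_inter le_rfl (Set.union_subset_union (Pre_mono act δP hXX') le_rfl)⟩

/-- The outer (monotone) operator Y ↦ μX. int≈(Y) ∩ (Pre(X) ∪ P_F). -/
def outerOp (sim : Hist Γ → Hist Γ → Prop) (h : Hist Γ → P) (act : Γ → A)
    (δP : P → Γ → P) (lam : Hist Γ → Bool) :
    Set (P ⊕ P × A) →o Set (P ⊕ P × A) :=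
  ⟨fun Y => OrderHom.lfp (innerOp sim h act δP lam Y),
   by
     intro Y Y' hYY'
     exact OrderHom.lfp.monotone fun X =>
       Set.inter_subset_inter (fun t ht t' hr => hYY' (ht t' hr)) le_rfl⟩

/-- The fixpoint Y* = νY. μX. int≈(Y) ∩ (Pre(X) ∪ P_F). -/
def Ystar (sim : Hist Γ → Hist Γ → Prop) (h : Hist Γ → P) (act : Γ → A)
    (δP : P → Γ → P) (lam : Hist Γ → Bool) : Set (P ⊕ P × A) :=
  OrderHom.gfp (outerOp sim h act δP lam)

/-- A probability distribution on a finite type. -/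
structure PDist (X : Type) [Fintype X] where
  f : X → ℝ
  nonneg : ∀ x, 0 ≤ f x
  sum_one : ∑ x, f x = 1

variable [Fintype Γ] [Fintype A]

/-- A strategy of the player is information consistent. -/
def IsPlayerStrat (sim : Hist Γ → Hist Γ → Prop) (α : Hist Γ → PDist A) : Prop :=
  ∀ τ τ' : Hist Γ, sim τ τ' → α τ = α τ'

/-- A strategy of the environment only plays moves supported by the given action. -/
def IsEnvStrat (act : Γ → A) (β : Hist Γ → A → PDist Γ) : Prop :=
  ∀ (τ : Hist Γ) (a : A) (c : Γ), 0 < (β τ a).f c → act c = a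

/-- Plays are infinite sequences of moves. -/
abbrev Play (Γ : Type) := ℕ → Γ

/-- The cylinder set spanned by a finite history. -/
def Cyl (ρ : List Γ) : Set (Play Γ) := {π | ∀ i : Fin ρ.length, π i.1 = ρ.get i}

/-- The σ-algebra on plays generated by cylinder sets. -/
instance playMS : MeasurableSpace (Play Γ) :=
  .generateFrom {s | ∃ ρ : List Γ, s = Cyl ρ}

/-- The probability that the game, started after history τ, follows a given
further sequence of moves, under strategies α and β. -/
noncomputable def extProb (act : Γ → A) (α : Hist Γ → PDist A) (β : Hist Γ → A → PDist Γ) :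
    Hist Γ → List Γ → ℝ
  | _, [] => 1
  | τ, c :: l => (α τ).f (act c) * (β τ (act c)).f c * extProb act α β (τ ++ [c]) l

/-- μ is the probability measure Pr_τ^{α,β}: its value on every cylinder set is prescribed. -/
def IsPrMeasure (act : Γ → A) (α : Hist Γ → PDist A) (β : Hist Γ → A → PDist Γ)
    (τ : Hist Γ) (μ : Measure (Play Γ)) : Prop :=
  IsProbabilityMeasure μ ∧
  ∀ ρ : Hist Γ, μ (Cyl ρ) =
    if ρ <+: τ then 1
    else if τ <+: ρ then ENNReal.ofReal (extProb act α β τ (ρ.drop τ.length))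
    else 0

/-- The reachability event: the set of plays having a finite prefix of color 1. -/
def ReachEvent (lam : Hist Γ → Bool) : Set (Play Γ) :=
  {π | ∃ n : ℕ, lam (List.ofFn fun i : Fin n => π i.1) = true}

/-- The strategy α is almost-sure winning from the information set [τ]~ for reachability. -/
def ASWinFrom (act : Γ → A) (sim : Hist Γ → Hist Γ → Prop) (lam : Hist Γ → Bool)
    (α : Hist Γ → PDist A) (τ : Hist Γ) : Prop :=
  ∀ τ' : Hist Γ, τ' ∈ InfoSet sim τ →
    ∀ β : Hist Γ → A → PDist Γ, IsEnvStrat act β →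
      ∀ μ : Measure (Play Γ), IsPrMeasure act α β τ' μ → μ (ReachEvent lam) = 1

/-- The set P_∃ of existentially winning abstract states. -/
def Pexists (act : Γ → A) (sim : Hist Γ → Hist Γ → Prop) (lam : Hist Γ → Bool)
    (h : Hist Γ → P) : Set P :=
  {p | ∃ τ : Hist Γ, h τ = p ∧
    ∃ α : Hist Γ → PDist A, IsPlayerStrat sim α ∧ ASWinFrom act sim lam α τ}

/-- The set P_∀ of universally winning abstract states. -/
def Pforall (act : Γ → A) (sim : Hist Γ → Hist Γ → Prop) (lam : Hist Γ → Bool)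
    (h : Hist Γ → P) : Set P :=
  {p | ∀ τ : Hist Γ, h τ = p →
    ∃ α : Hist Γ → PDist A, IsPlayerStrat sim α ∧ ASWinFrom act sim lam α τ}

end Games

section Helpers

variable {Γ A : Type}

/-- The length-`n` prefix of a play. -/
def preN (π : Play Γ) (n : ℕ) : List Γ := List.ofFn fun i : Fin n => π i.1

lemma preN_length (π : Play Γ) (n : ℕ) : (preN π n).length = n := by simp [preN]

lemma preN_succ (π : Play Γ) (n : ℕ) : preN π (n + 1) = preN π n ++ [π n] := by
  rw [preN, List.ofFn_succ_last]; rfl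

lemma preN_prefix (π : Play Γ) {n m : ℕ} (hnm : n ≤ m) : preN π n <+: preN π m := by
  induction hnm with
  | refl => exact List.prefix_refl _
  | step _ ih => exact ih.trans (by rw [preN_succ]; exact List.prefix_append _ _)

lemma mem_Cyl_iff (π : Play Γ) (ρ : List Γ) : π ∈ Cyl ρ ↔ preN π ρ.length = ρ := by
  constructor
  · intro hπ
    apply List.ext_get
    · simp [preN]
    · intro n h1 h2
      have := hπ ⟨n, h2⟩
      simpa [preN] using this
  · intro hπ i
    have h2 : ∀ (σ : List Γ) (h : i.1 < σ.length), preN π ρ.length = σ →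
        π i.1 = σ.get ⟨i.1, h⟩ := by
      intro σ h hσ
      subst hσ
      simp [preN]
    exact h2 ρ i.2 hπ

lemma mem_Cyl_preN (π : Play Γ) (n : ℕ) : π ∈ Cyl (preN π n) := by
  rw [mem_Cyl_iff, preN_length]

lemma Cyl_anti {ρ σ : List Γ} (hp : ρ <+: σ) : Cyl σ ⊆ Cyl ρ := by
  intro π hπ
  rw [mem_Cyl_iff] at hπ ⊢
  have h1 : preN π ρ.length <+: σ := by
    have := preN_prefix π hp.length_le
    rwa [hπ] at this
  exact (List.prefix_of_prefix_length_le h1 hp (by simp [preN])).eq_of_length (by simp [preN])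

lemma Cyl_comparable {ρ σ : List Γ} {π : Play Γ} (h1 : π ∈ Cyl ρ) (h2 : π ∈ Cyl σ) :
    ρ <+: σ ∨ σ <+: ρ := by
  rw [mem_Cyl_iff] at h1 h2
  rcases le_total ρ.length σ.length with hl | hl
  · left
    have := preN_prefix π hl
    rwa [h1, h2] at this
  · right
    have := preN_prefix π hl
    rwa [h1, h2] at this

lemma measurable_Cyl (ρ : List Γ) : MeasurableSet (Cyl ρ) :=
  MeasurableSpace.measurableSet_generateFrom ⟨ρ, rfl⟩

lemma isPiSystem_Cyl : IsPiSystem {s : Set (Play Γ) | ∃ ρ : List Γ, s = Cyl ρ} := by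
  rintro _ ⟨ρ, rfl⟩ _ ⟨σ, rfl⟩ ⟨π, h1, h2⟩
  rcases Cyl_comparable h1 h2 with hp | hp
  · exact ⟨σ, Set.inter_eq_right.2 (Cyl_anti hp)⟩
  · exact ⟨ρ, Set.inter_eq_left.2 (Cyl_anti hp)⟩

lemma measurable_Reach [Fintype Γ] (lam : Hist Γ → Bool) : MeasurableSet (ReachEvent lam) := by
  have : ReachEvent lam = ⋃ ρ : {ρ : List Γ // lam ρ = true}, Cyl ρ.1 := by
    ext π
    simp only [Set.mem_iUnion]
    constructor
    · rintro ⟨n, hn⟩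
      exact ⟨⟨preN π n, hn⟩, mem_Cyl_preN π n⟩
    · rintro ⟨⟨ρ, hρ⟩, hπ⟩
      rw [mem_Cyl_iff] at hπ
      refine ⟨ρ.length, ?_⟩
      change lam (preN π ρ.length) = true
      rw [hπ]
      exact hρ
  rw [this]
  exact MeasurableSet.iUnion fun ρ => measurable_Cyl _

/-- The history generated from `τ` by a choice function `ω`. -/
def hst (τ : List Γ) (ω : List Γ → Γ) : ℕ → List Γ
  | 0 => []
  | n + 1 => hst τ ω n ++ [if h : n < τ.length then τ[n] else ω (hst τ ω n)]

/-- The play generated from `τ` by a choice function `ω`. -/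
def genPlay (τ : List Γ) (ω : List Γ → Γ) : Play Γ :=
  fun n => if h : n < τ.length then τ[n] else ω (hst τ ω n)

lemma preN_genPlay (τ : List Γ) (ω : List Γ → Γ) (n : ℕ) :
    preN (genPlay τ ω) n = hst τ ω n := by
  induction n with
  | zero => simp [preN, hst]
  | succ n ih => rw [preN_succ, ih]; rfl

lemma hst_of_le (τ : List Γ) (ω : List Γ → Γ) (n : ℕ) (hn : n ≤ τ.length) :
    hst τ ω n = τ.take n := by
  induction n with
  | zero => simp [hst]
  | succ n ih =>
    have hn' : n < τ.length := hn
    rw [hst, ih hn'.le, dif_pos hn', List.take_append_getElem]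

lemma hst_append (τ : List Γ) (ω : List Γ → Γ) (l : List Γ) :
    hst τ ω (τ.length + l.length) = τ ++ l ↔
      ∀ i (h : i < l.length), ω (τ ++ l.take i) = l[i] := by
  induction l using List.reverseRecOn with
  | nil => simp [hst_of_le]
  | append_singleton l c ih =>
    have e : τ.length + (l ++ [c]).length = (τ.length + l.length) + 1 := by simp; omega
    rw [e, hst, dif_neg (by omega), ← List.append_assoc, List.append_singleton_inj]
    constructor
    · rintro ⟨h1, h2⟩ i hi
      rw [h1] at h2
      rcases Nat.lt_or_ge i l.length with h | h
      · rw [List.take_append_of_le_length h.le, List.getElem_append_left h]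
        exact ih.1 h1 i h
      · have : i = l.length := by simp at hi; omega
        subst this
        simpa using h2
    · intro H
      have h1 : hst τ ω (τ.length + l.length) = τ ++ l := by
        rw [ih]
        intro i hi
        have := H i (by simp; omega)
        rwa [List.take_append_of_le_length hi.le, List.getElem_append_left hi] at this
      refine ⟨h1, ?_⟩
      rw [h1]
      simpa using H l.length (by simp)

variable [Fintype Γ] [Fintype A]

lemma extProb_eq_prod (act : Γ → A) (α : Hist Γ → PDist A) (β : Hist Γ → A → PDist Γ)
    (l : List Γ) : ∀ τ : Hist Γ, extProb act α β τ l =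
      ∏ i : Fin l.length, ((α (τ ++ l.take i)).f (act l[i]) *
        (β (τ ++ l.take i) (act l[i])).f l[i]) := by
  induction l with
  | nil => intro τ; simp [extProb]
  | cons c l ih =>
    intro τ
    rw [extProb, ih]
    simp only [List.length_cons]
    rw [Fin.prod_univ_succ]
    simp

lemma extProb_nonneg (act : Γ → A) (α : Hist Γ → PDist A) (β : Hist Γ → A → PDist Γ)
    (l : List Γ) (τ : Hist Γ) : 0 ≤ extProb act α β τ l := by
  rw [extProb_eq_prod]
  exact Finset.prod_nonneg fun i _ => mul_nonneg ((α _).nonneg _) ((β _ _).nonneg _)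

lemma extProb_congr (act : Γ → A) (α : Hist Γ → PDist A) (β β' : Hist Γ → A → PDist Γ)
    (l : List Γ) : ∀ τ : Hist Γ, (∀ ρ : Hist Γ, τ.length ≤ ρ.length → β ρ = β' ρ) →
      extProb act α β τ l = extProb act α β' τ l := by
  induction l with
  | nil => intro τ _; simp [extProb]
  | cons c l ih =>
    intro τ hτ
    rw [extProb, extProb, hτ τ le_rfl, ih (τ ++ [c])]
    intro ρ hρ
    apply hτ
    simp at hρ
    omega

lemma step_sum (act : Γ → A) (p : PDist A) (q : A → PDist Γ)
    (hq : ∀ a c, 0 < (q a).f c → act c = a) :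
    ∑ c, p.f (act c) * (q (act c)).f c = 1 := by
  have h0 : ∀ a c, act c ≠ a → (q a).f c = 0 := by
    intro a c hne
    by_contra hcon
    exact hne (hq a c (lt_of_le_of_ne ((q a).nonneg c) (Ne.symm hcon)))
  calc ∑ c, p.f (act c) * (q (act c)).f c
      = ∑ c, ∑ a, p.f a * (q a).f c := by
        refine Finset.sum_congr rfl fun c _ => ?_
        rw [Finset.sum_eq_single (act c)]
        · intro a _ hne
          rw [h0 a c hne.symm, mul_zero]
        · simp
    _ = ∑ a, ∑ c, p.f a * (q a).f c := Finset.sum_comm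
    _ = ∑ a, p.f a := by
        refine Finset.sum_congr rfl fun a _ => ?_
        rw [← Finset.mul_sum, (q a).sum_one, mul_one]
    _ = 1 := p.sum_one

/-- Existence of the probability measure on plays. -/
lemma exists_isPrMeasure (act : Γ → A) (α : Hist Γ → PDist A) (β : Hist Γ → A → PDist Γ)
    (hβ : IsEnvStrat act β) (τ : Hist Γ) :
    ∃ μ : Measure (Play Γ), IsPrMeasure act α β τ μ := by
  letI : MeasurableSpace Γ := ⊤
  haveI : MeasurableSingletonClass Γ := ⟨fun _ => trivial⟩
  have hsum : ∀ ρ : Hist Γ,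
      ∑ c, ENNReal.ofReal ((α ρ).f (act c) * (β ρ (act c)).f c) = 1 := by
    intro ρ
    rw [← ENNReal.ofReal_sum_of_nonneg
      (fun c _ => mul_nonneg ((α ρ).nonneg _) ((β ρ _).nonneg _)),
      step_sum act (α ρ) (β ρ) (hβ ρ), ENNReal.ofReal_one]
  let q : Hist Γ → PMF Γ := fun ρ => PMF.ofFintype _ (hsum ρ)
  let m : Hist Γ → Measure Γ := fun ρ => (q ρ).toMeasure
  have hm : ∀ ρ c, m ρ {c} = ENNReal.ofReal ((α ρ).f (act c) * (β ρ (act c)).f c) := by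
    intro ρ c
    simp only [m]
    rw [PMF.toMeasure_apply_singleton _ _ (measurableSet_singleton c)]
    rfl
  have hτ : ∀ ω, genPlay τ ω ∈ Cyl τ := by
    intro ω
    rw [mem_Cyl_iff, preN_genPlay, hst_of_le _ _ _ le_rfl, List.take_length]
  -- preimages of cylinders
  have hpre1 : ∀ ρ, ρ <+: τ → genPlay τ ⁻¹' Cyl ρ = Set.univ := by
    intro ρ hρ
    exact Set.eq_univ_of_forall fun ω => Cyl_anti hρ (hτ ω)
  have hpre3 : ∀ ρ, ¬ ρ <+: τ → ¬ τ <+: ρ → genPlay τ ⁻¹' Cyl ρ = ∅ := by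
    intro ρ h1 h2
    refine Set.eq_empty_of_forall_notMem fun ω hω => ?_
    rcases Cyl_comparable hω (hτ ω) with h | h
    · exact h1 h
    · exact h2 h
  have hpre2 : ∀ l : List Γ, genPlay τ ⁻¹' Cyl (τ ++ l) =
      Set.pi (Finset.univ.image fun i : Fin l.length => τ ++ l.take i : Finset (List Γ))
        (fun ρ => {c | ρ ++ [c] <+: τ ++ l}) := by
    intro l
    ext ω
    rw [Set.mem_preimage, mem_Cyl_iff, preN_genPlay, List.length_append, hst_append]
    simp only [Set.mem_pi, Finset.coe_image, Set.mem_image, Finset.coe_univ, Set.mem_univ,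
      true_and, Set.mem_setOf_eq, forall_exists_index, forall_apply_eq_imp_iff]
    have key : ∀ (i : ℕ) (h : i < l.length) (c : Γ),
        τ ++ l.take i ++ [c] <+: τ ++ l ↔ c = l[i] := by
      intro i h c
      rw [List.append_assoc, List.prefix_append_right_inj]
      constructor
      · intro hp
        have := List.IsPrefix.getElem hp (i := i) (by simp; omega)
        rw [← this]
        simp [List.getElem_append, h.le]
      · rintro rfl
        rw [List.take_append_getElem]
        exact List.take_prefix _ _
    constructor
    · intro H i
      exact (key i i.2 _).2 (H i i.2)
    · intro H i hi
      exact (key i hi _).1 (H ⟨i, hi⟩)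
  have hval2 : ∀ l : List Γ, Measure.infinitePi m (genPlay τ ⁻¹' Cyl (τ ++ l)) =
      ENNReal.ofReal (extProb act α β τ l) := by
    intro l
    rw [hpre2, Measure.infinitePi_pi _ (fun _ _ => MeasurableSpace.measurableSet_top), Finset.prod_image, extProb_eq_prod,
      ENNReal.ofReal_prod_of_nonneg
        (fun i _ => mul_nonneg ((α _).nonneg _) ((β _ _).nonneg _))]
    · refine Finset.prod_congr rfl fun i _ => ?_
      rw [← hm]
      congr 1
      ext c
      simp only [Set.mem_setOf_eq, Set.mem_singleton_iff]
      rw [List.append_assoc, List.prefix_append_right_inj]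
      constructor
      · intro hp
        have := List.IsPrefix.getElem hp (i := i) (by simp)
        rw [← Fin.getElem_fin] at *
        simpa [List.getElem_append] using this
      · rintro rfl
        simp only [Fin.getElem_fin]
        rw [List.take_append_getElem]
        exact List.take_prefix _ _
    · intro i _ j _ hij
      have := congrArg List.length hij
      simp at this
      ext
      omega
  have hmeas : Measurable (genPlay τ) := by
    apply measurable_generateFrom
    rintro _ ⟨ρ, rfl⟩
    by_cases h1 : ρ <+: τ
    · rw [hpre1 ρ h1]; exact MeasurableSet.univ
    · by_cases h2 : τ <+: ρ
      · obtain ⟨l, rfl⟩ := h2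
        rw [hpre2]
        exact MeasurableSet.pi (Finset.countable_toSet _) fun _ _ => trivial
      · rw [hpre3 ρ h1 h2]; exact MeasurableSet.empty
  refine ⟨(Measure.infinitePi m).map (genPlay τ), ?_, ?_⟩
  · exact Measure.isProbabilityMeasure_map hmeas.aemeasurable
  · intro ρ
    rw [Measure.map_apply hmeas (measurable_Cyl ρ)]
    split_ifs with h1 h2
    · rw [hpre1 ρ h1]; exact measure_univ
    · obtain ⟨l, rfl⟩ := h2
      rw [hval2, List.drop_left]
    · rw [hpre3 ρ h1 h2]; exact measure_empty

/-- The Dirac distribution. -/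
noncomputable def diracDist (c : Γ) : PDist Γ where
  f := fun x => if x = c then 1 else 0
  nonneg := fun x => by split_ifs <;> norm_num
  sum_one := by simp

end Helpers



/-- If α is almost-sure winning from [τ]~, then for every action a in the support
of α(τ) and every move c supported by a, α is almost-sure winning from [τc]~. -/
theorem asWin_extend {Γ A P : Type} [Fintype Γ] [Nonempty Γ] [Fintype A] [Nonempty A] [Fintype P]
    (act : Γ → A) (hact : Function.Surjective act)
    (sim : Hist Γ → Hist Γ → Prop) (hsim : IsIndist act sim)
    (lam : Hist Γ → Bool) (hcons : InfoConsistent sim lam) (habs : Absorbing lam)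
    (h : Hist Γ → P) (hh : IsRectMorphism sim lam h)
    (α : Hist Γ → PDist A) (hα : IsPlayerStrat sim α)
    (τ : Hist Γ) (hwin : ASWinFrom act sim lam α τ)
    (a : A) (ha : 0 < (α τ).f a) (c : Γ) (hc : act c = a) :
    ASWinFrom act sim lam α (τ ++ [c]) := by
  intro σ hσ β hβ μ hμ
  change sim σ (τ ++ [c]) at hσ
  obtain ⟨τ', c', rfl⟩ : ∃ τ' c', σ = τ' ++ [c'] := by
    have hl := hsim.length_eq _ _ hσ
    rcases List.eq_nil_or_concat σ with h0 | ⟨t, d, h0⟩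
    · subst h0; simp at hl
    · exact ⟨t, d, by simpa using h0⟩
  obtain ⟨hs, hac⟩ := hsim.prefix_act _ _ _ _ hσ
  have hca : act c' = a := hac.trans hc
  have ha' : 0 < (α τ').f a := by rw [hα _ _ hs]; exact ha
  let β' : Hist Γ → A → PDist Γ := fun ρ b => if ρ = τ' ∧ b = a then diracDist c' else β ρ b
  have hβ' : IsEnvStrat act β' := by
    intro ρ b d hd
    simp only [β'] at hd
    split_ifs at hd with hif
    · simp only [diracDist] at hd
      split_ifs at hd with hdc
      · rw [hdc, hca, hif.2]
      · exact absurd hd (lt_irrefl _)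
    · exact hβ ρ b d hd
  have hββ' : ∀ ρ : Hist Γ, (τ' ++ [c']).length ≤ ρ.length → β' ρ = β ρ := by
    intro ρ hρ
    funext b
    have : ρ ≠ τ' := by
      rintro rfl
      simp at hρ
    simp [β', this]
  obtain ⟨ν, hν⟩ := exists_isPrMeasure act α β' hβ' τ'
  have hνR := hwin τ' hs β' hβ' ν hν
  haveI := hν.1
  haveI := hμ.1
  set p : ENNReal := ENNReal.ofReal ((α τ').f a) with hp
  have hp0 : p ≠ 0 := by
    rw [hp]; simpa using ha'
  -- the value of `ν` on cylinders beyond `τ' ++ [c']`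
  have hνc : ∀ l : List Γ, ν (Cyl (τ' ++ [c'] ++ l)) =
      p * ENNReal.ofReal (extProb act α β (τ' ++ [c']) l) := by
    intro l
    rw [hν.2, if_neg, if_pos, List.append_assoc, List.drop_left, hp,
      ← ENNReal.ofReal_mul ha'.le]
    · congr 1
      simp only [List.singleton_append, extProb]
      rw [extProb_congr act α β' β l _ hββ', hca]
      simp [β', diracDist]
    · rw [List.append_assoc]; exact List.prefix_append _ _
    · intro hpre
      have := hpre.length_le
      simp at this
  have hμc : ∀ l : List Γ, μ (Cyl (τ' ++ [c'] ++ l)) =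
      ENNReal.ofReal (extProb act α β (τ' ++ [c']) l) := by
    intro l
    rw [hμ.2]
    split_ifs with h1 h2
    · have := h1.length_le
      have hl : l = [] := by
        apply List.eq_nil_of_length_eq_zero
        simp at this
        simpa using this
      subst hl
      simp [extProb]
    · rw [List.drop_left]
    · exact absurd (List.prefix_append _ _) h2
  have hνcyl : ν (Cyl (τ' ++ [c'])) = p := by
    have := hνc []
    simpa [extProb] using this
  have hmain : ν.restrict (Cyl (τ' ++ [c'])) = p • μ := by
    refine ext_of_generate_finite {s | ∃ ρ : List Γ, s = Cyl ρ} rfl isPiSystem_Cyl ?_ ?_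
    · rintro _ ⟨ρ, rfl⟩
      rw [Measure.restrict_apply (measurable_Cyl ρ), Measure.smul_apply, smul_eq_mul]
      by_cases h1 : ρ <+: τ' ++ [c']
      · rw [Set.inter_eq_right.2 (Cyl_anti h1), hνcyl, hμ.2, if_pos h1, mul_one]
      · by_cases h2 : τ' ++ [c'] <+: ρ
        · rw [Set.inter_eq_left.2 (Cyl_anti h2)]
          obtain ⟨l, rfl⟩ := h2
          rw [hνc, hμc]
        · rw [hμ.2, if_neg h1, if_neg h2, mul_zero]
          have : Cyl ρ ∩ Cyl (τ' ++ [c']) = ∅ := by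
            refine Set.eq_empty_of_forall_notMem fun π hπ => ?_
            rcases Cyl_comparable hπ.1 hπ.2 with h | h
            · exact h1 h
            · exact h2 h
          rw [this, measure_empty]
    · rw [Measure.restrict_apply MeasurableSet.univ, Set.univ_inter, hνcyl, Measure.smul_apply,
        measure_univ, smul_eq_mul, mul_one]
  have hR := measurable_Reach (Γ := Γ) lam
  have h0 : ν (ReachEvent lam)ᶜ = 0 := (prob_compl_eq_zero_iff hR).2 hνR
  have h1 : (p • μ) (ReachEvent lam)ᶜ = 0 := by
    rw [← hmain]
    exact le_antisymm ((Measure.restrict_apply_le _ _).trans h0.le) bot_le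
  rw [Measure.smul_apply, smul_eq_mul, mul_eq_zero] at h1
  exact (prob_compl_eq_zero_iff hR).1 (h1.resolve_left hp0)
end

section
/- Let ~ be an indistinguishability relation on Γ*, λ an information-consistent absorbing coloring, and h : Γ* → P a rectangular morphism. Then the set P_∃ of existentially winning states is closed under ≈: if p ∈ P_∃ and p ≈ p', then p' ∈ P_∃. -/
open MeasureTheory
open scoped Classical

/-- The set P_∃ of existentially winning states is closed under ≈. -/
theorem Pexists_closed {Γ A P : Type} [Fintype Γ] [Nonempty Γ] [Fintype A] [Nonempty A] [Fintype P]
    (act : Γ → A) (hact : Function.Surjective act)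
    (sim : Hist Γ → Hist Γ → Prop) (hsim : IsIndist act sim)
    (lam : Hist Γ → Bool) (hcons : InfoConsistent sim lam) (habs : Absorbing lam)
    (h : Hist Γ → P) (hh : IsRectMorphism sim lam h)
    (p p' : P) (hp : p ∈ Pexists act sim lam h) (hpp' : approx sim h p p') :
    p' ∈ Pexists act sim lam h := by
  obtain ⟨τ₀, h₀, α, hα, hw⟩ := hp
  obtain ⟨τ₁, τ₂, h12, h₁, h₂⟩ := hpp'
  have hmem : p' ∈ h '' InfoSet sim τ₁ := ⟨τ₂, hsim.equiv.symm h12, h₂⟩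
  rw [hh.rect τ₁ τ₀ (h₁.trans h₀.symm)] at hmem
  obtain ⟨τ₃, h30, h₃⟩ := hmem
  exact ⟨τ₃, h₃, α, hα, fun τ' hτ' => hw τ' (hsim.equiv.trans hτ' h30)⟩
end

section
/- Let ~ be an indistinguishability relation on Γ*, λ an information-consistent absorbing coloring, and h : Γ* → P a rectangular morphism. Then the set P_∀ of universally winning states is closed under ≈: if p ∈ P_∀ and p ≈ p', then p' ∈ P_∀. -/
open MeasureTheory
open scoped Classical

/-- The set P_∀ of universally winning states is closed under ≈. -/
theorem Pforall_closed {Γ A P : Type} [Fintype Γ] [Nonempty Γ] [Fintype A] [Nonempty A] [Fintype P]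
    (act : Γ → A) (hact : Function.Surjective act)
    (sim : Hist Γ → Hist Γ → Prop) (hsim : IsIndist act sim)
    (lam : Hist Γ → Bool) (hcons : InfoConsistent sim lam) (habs : Absorbing lam)
    (h : Hist Γ → P) (hh : IsRectMorphism sim lam h)
    (p p' : P) (hp : p ∈ Pforall act sim lam h) (hpp' : approx sim h p p') :
    p' ∈ Pforall act sim lam h := by
  obtain ⟨τ, τ', hs, h1, h2⟩ := hpp'
  intro σ' hσ'
  have hmem : h τ ∈ h '' InfoSet sim τ' := ⟨τ, hs, rfl⟩
  rw [hh.rect τ' σ' (h2.trans hσ'.symm)] at hmem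
  obtain ⟨σ, hσ, hσe⟩ := hmem
  obtain ⟨α, hα, hw⟩ := hp σ (hσe.trans h1)
  exact ⟨α, hα, fun ρ hρ => hw ρ (hsim.equiv.trans hρ (hsim.equiv.symm hσ))⟩
end

section
/- Let ~ be an indistinguishability relation on Γ*, λ an information-consistent absorbing coloring, and h : Γ* → P a rectangular morphism. Then the fixpoint Y* satisfies: (i) Y* is closed under ≈, i.e., Y* = int≈(Y*); (ii) Y* ⊆ Pre(Y*) ∪ P_F; and (iii) P_F ⊆ Y*. -/
open MeasureTheory
open scoped Classical

/-- The fixpoint Y* is closed under ≈, satisfies Y* ⊆ Pre(Y*) ∪ P_F,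
and contains P_F. -/
theorem Ystar_properties {Γ A P : Type} [Fintype Γ] [Nonempty Γ] [Fintype A] [Nonempty A] [Fintype P]
    (act : Γ → A) (hact : Function.Surjective act)
    (sim : Hist Γ → Hist Γ → Prop) (hsim : IsIndist act sim)
    (lam : Hist Γ → Bool) (hcons : InfoConsistent sim lam) (habs : Absorbing lam)
    (h : Hist Γ → P) (hh : IsRectMorphism sim lam h)
    (δP : P → Γ → P) (hδ : ∀ (τ : Hist Γ) (c : Γ), δP (h τ) c = h (τ ++ [c])) :
    Ystar sim h act δP lam = intr (approxS sim h) (Ystar sim h act δP lam) ∧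
    Ystar sim h act δP lam ⊆
      Pre act δP (Ystar sim h act δP lam) ∪ targetS A lam h ∧
    targetS A lam h ⊆ Ystar sim h act δP lam := by
  have hfix : Ystar sim h act δP lam =
      intr (approxS sim h) (Ystar sim h act δP lam) ∩
        (Pre act δP (Ystar sim h act δP lam) ∪ targetS A lam h) := by
    have h1 : OrderHom.lfp (innerOp sim h act δP lam (Ystar sim h act δP lam)) =
        Ystar sim h act δP lam := OrderHom.map_gfp (outerOp sim h act δP lam)
    have h2 := OrderHom.map_lfp (innerOp sim h act δP lam (Ystar sim h act δP lam))
    rw [h1] at h2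
    exact h2.symm
  have hrefl : ∀ p : P, approx sim h p p := by
    intro p
    obtain ⟨τ, rfl⟩ := hh.surj p
    exact ⟨τ, τ, hsim.equiv.refl τ, rfl, rfl⟩
  refine ⟨Set.Subset.antisymm (fun s hs => (hfix.subset hs).1) ?_,
    fun s hs => (hfix.subset hs).2, ?_⟩
  · intro s hs
    apply hs s
    rcases s with p | ⟨p, a⟩
    · exact hrefl p
    · exact ⟨hrefl p, rfl⟩
  · apply OrderHom.le_gfp
    change targetS A lam h ⊆ OrderHom.lfp (innerOp sim h act δP lam (targetS A lam h))
    rw [← OrderHom.map_lfp]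
    intro s hs
    refine ⟨?_, Or.inr hs⟩
    obtain ⟨p, ⟨τ, rfl, hτ⟩, rfl⟩ := hs
    intro t ht
    rcases t with q | ⟨q, a⟩
    · obtain ⟨τ₁, τ₂, h12, rfl, h2⟩ := ht
      exact ⟨h τ₁, ⟨τ₁, rfl, by rw [hcons _ _ h12, hh.refines _ _ h2, hτ]⟩, rfl⟩
    · exact ht.elim
end

section
/- Let ~ be an indistinguishability relation on Γ*, λ an information-consistent absorbing coloring, and h : Γ* → P a rectangular morphism. Then for every abstract state p ∈ Y* ∩ P, the set A_p = {a ∈ A | (p, a) ∈ Y*} is nonempty. -/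
open MeasureTheory
open scoped Classical

/-- For every abstract state p ∈ Y* ∩ P, the set A_p = {a | (p,a) ∈ Y*} is nonempty. -/
theorem Ap_nonempty {Γ A P : Type} [Fintype Γ] [Nonempty Γ] [Fintype A] [Nonempty A] [Fintype P]
    (act : Γ → A) (hact : Function.Surjective act)
    (sim : Hist Γ → Hist Γ → Prop) (hsim : IsIndist act sim)
    (lam : Hist Γ → Bool) (hcons : InfoConsistent sim lam) (habs : Absorbing lam)
    (h : Hist Γ → P) (hh : IsRectMorphism sim lam h)
    (δP : P → Γ → P) (hδ : ∀ (τ : Hist Γ) (c : Γ), δP (h τ) c = h (τ ++ [c]))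
    (p : P) (hp : Sum.inl p ∈ Ystar sim h act δP lam) :
    {a : A | Sum.inr (p, a) ∈ Ystar sim h act δP lam}.Nonempty := by
  have hfinal : ∀ q q' : P, approx sim h q' q → q ∈ targetSet lam h → q' ∈ targetSet lam h := by
    rintro q q' ⟨τ, τ', hs, rfl, rfl⟩ ⟨σ, hσ, hl⟩
    exact ⟨τ, rfl, by rw [hcons _ _ hs, ← hh.refines _ _ hσ, hl]⟩
  have hstep : ∀ (q : P) (c : Γ), q ∈ targetSet lam h → δP q c ∈ targetSet lam h := by
    rintro q c ⟨σ, rfl, hl⟩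
    exact ⟨σ ++ [c], (hδ σ c).symm, habs σ c hl⟩
  have hfix : outerOp sim h act δP lam (Ystar sim h act δP lam) = Ystar sim h act δP lam :=
    OrderHom.map_gfp _
  have hfix2 : innerOp sim h act δP lam (Ystar sim h act δP lam) (Ystar sim h act δP lam)
      = Ystar sim h act δP lam := by
    have h1 := OrderHom.map_lfp (innerOp sim h act δP lam (Ystar sim h act δP lam))
    have h2 : OrderHom.lfp (innerOp sim h act δP lam (Ystar sim h act δP lam))
      = Ystar sim h act δP lam := hfix
    rwa [h2] at h1
  rw [← hfix2] at hp
  obtain ⟨-, hpre | ht⟩ := hp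
  · exact hpre
  · obtain ⟨q, hq, hqp⟩ := ht
    obtain rfl : q = p := Sum.inl.inj hqp
    let F : Set (P ⊕ P × A) := {s | Sum.elim id Prod.fst s ∈ targetSet lam h}
    have hint : F ⊆ intr (approxS sim h) F := by
      intro s hs t hr
      rcases s with q1 | ⟨q1, a1⟩ <;> rcases t with q2 | ⟨q2, a2⟩
      · exact hfinal q1 q2 hr hs
      · exact hr.elim
      · exact hr.elim
      · exact hfinal q1 q2 hr.1 hs
    have hpost : F ≤ outerOp sim h act δP lam F := by
      have hL := OrderHom.map_lfp (innerOp sim h act δP lam F)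
      have hl : ∀ q1 : P, q1 ∈ targetSet lam h →
          (Sum.inl q1 : P ⊕ P × A) ∈ OrderHom.lfp (innerOp sim h act δP lam F) := by
        intro q1 h1
        rw [← hL]
        exact ⟨hint h1, Or.inr ⟨q1, h1, rfl⟩⟩
      intro s hs
      rcases s with q1 | ⟨q1, a1⟩
      · exact hl q1 hs
      · change _ ∈ OrderHom.lfp (innerOp sim h act δP lam F)
        rw [← hL]
        exact ⟨hint hs, Or.inl fun c _ => hl _ (hstep q1 c hs)⟩
    obtain ⟨a⟩ := ‹Nonempty A›
    exact ⟨a, OrderHom.le_gfp _ hpost (show Sum.inr (q, a) ∈ F from hq)⟩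
end

section
/- Let ~ be an indistinguishability relation on Γ*, λ an information-consistent absorbing coloring, and h : Γ* → P a rectangular morphism. Then for every pair (p, a) ∈ Y* with p ∈ P and a ∈ A, and for every move c ∈ Γ with act(c) = a, the successor δ^P(p, c) belongs to Y*. Consequently, the strategy playing only actions a with (h(τ), a) ∈ Y* from any history τ with h(τ) ∈ Y* never leaves Y*. -/
open MeasureTheory
open scoped Classical

/-- Pairs in Y* only lead to states in Y*: if (p,a) ∈ Y* and act(c) = a then
δ^P(p,c) ∈ Y*; consequently playing only actions a with (h(τ),a) ∈ Y* never leaves Y*. -/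
theorem Ystar_never_left {Γ A P : Type} [Fintype Γ] [Nonempty Γ] [Fintype A] [Nonempty A] [Fintype P]
    (act : Γ → A) (hact : Function.Surjective act)
    (sim : Hist Γ → Hist Γ → Prop) (hsim : IsIndist act sim)
    (lam : Hist Γ → Bool) (hcons : InfoConsistent sim lam) (habs : Absorbing lam)
    (h : Hist Γ → P) (hh : IsRectMorphism sim lam h)
    (δP : P → Γ → P) (hδ : ∀ (τ : Hist Γ) (c : Γ), δP (h τ) c = h (τ ++ [c])) :
    (∀ (p : P) (a : A), Sum.inr (p, a) ∈ Ystar sim h act δP lam →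
      ∀ c : Γ, act c = a → Sum.inl (δP p c) ∈ Ystar sim h act δP lam) ∧
    (∀ τ : Hist Γ, Sum.inl (h τ) ∈ Ystar sim h act δP lam →
      ∀ a : A, Sum.inr (h τ, a) ∈ Ystar sim h act δP lam →
        ∀ c : Γ, act c = a → Sum.inl (h (τ ++ [c])) ∈ Ystar sim h act δP lam) := by
  have hfix : innerOp sim h act δP lam (Ystar sim h act δP lam) (Ystar sim h act δP lam)
      = Ystar sim h act δP lam := by
    have h1 : OrderHom.lfp (innerOp sim h act δP lam (Ystar sim h act δP lam))
        = Ystar sim h act δP lam := OrderHom.map_gfp (outerOp sim h act δP lam)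
    have h2 := OrderHom.map_lfp (innerOp sim h act δP lam (Ystar sim h act δP lam))
    rwa [h1] at h2
  have key : ∀ (p : P) (a : A), Sum.inr (p, a) ∈ Ystar sim h act δP lam →
      ∀ c : Γ, act c = a → Sum.inl (δP p c) ∈ Ystar sim h act δP lam := by
    intro p a hpa c hc
    rw [← hfix] at hpa
    rcases hpa.2 with hpre | ⟨q, _, hq⟩
    · exact hpre c hc
    · cases hq
  refine ⟨key, fun τ _ a ha c hc => ?_⟩
  rw [← hδ]
  exact key _ a ha c hc
end
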